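/- arXiv:1803.05227 — 7 statements merged into one kernel-verified Lean document; each statement's English description precedes it below -/
import Mathlib

section
/- Let n be a natural number, let V and V' be complex vector spaces both of dimension n+1, and let (e,f,h) on V and (e',f',h') on V' be two irreducible triples of linear endomorphisms each satisfying h∘e − e∘h = 2e, f∘h − h∘f = 2f, f∘e − e∘f = h. Then the two triples are equivalent: there exists a linear equivalence T : V ≃ V' with T∘e = e'∘T, T∘f = f'∘T and T∘h = h'∘T. -/
section HighestWeight

variable {V : Type*} [AddCommGroup V] [Module ℂ V] [FiniteDimensional ℂ V]

/-- A sequence of eigenvectors whose eigenvalues form a nonconstant arithmetic progression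
vanishes somewhere. -/
theorem exists_eq_zero_of_arithmetic_weights (h : V →ₗ[ℂ] V) (μ c : ℂ) (hc : c ≠ 0) (u : ℕ → V)
    (hu : ∀ k, h (u k) = (μ + c * k) • u k) : ∃ k, u k = 0 := by
  by_contra! hne
  have hinj : Function.Injective fun k : ℕ => μ + c * k := fun a b hab => by
    simpa [hc] using hab
  have hli := Module.End.eigenvectors_linearIndependent' h _ hinj u fun k =>
    ⟨Module.End.mem_eigenspace_iff.mpr (hu k), hne k⟩
  have := hli.finite
  exact not_finite ℕ

/-- There is an eigenvector of `h` killed by `e`. -/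
theorem exists_highest_weight_vector [Nontrivial V] (e h : V →ₗ[ℂ] V)
    (he : ∀ x, h (e x) = e (h x) + (2 : ℂ) • e x) :
    ∃ (v : V) (μ : ℂ), v ≠ 0 ∧ e v = 0 ∧ h v = μ • v := by
  obtain ⟨μ, hμ⟩ := Module.End.exists_eigenvalue h
  obtain ⟨x, hx⟩ := hμ.exists_hasEigenvector
  have hw : ∀ k : ℕ, h (e^[k] x) = (μ + 2 * k) • e^[k] x := by
    intro k
    induction k with
    | zero => simpa using hx.apply_eq_smul
    | succ k ih =>
      rw [Function.iterate_succ_apply', he, ih, map_smul, ← add_smul]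
      congr 1
      push_cast
      ring
  obtain ⟨k, hk, hk'⟩ := Nat.exists_not_and_succ_of_not_zero_of_exists
    (p := fun k => e^[k] x = 0) hx.2
    (exists_eq_zero_of_arithmetic_weights h μ 2 two_ne_zero _ hw)
  exact ⟨e^[k] x, _, hk, by rwa [← Function.iterate_succ_apply' (f := e)], hw k⟩

/-- An irreducible triple of dimension `n + 1` has a standard weight basis. -/
theorem exists_weight_basis (n : ℕ) (hdim : Module.finrank ℂ V = n + 1) (e f h : V →ₗ[ℂ] V)
    (he : h ∘ₗ e - e ∘ₗ h = 2 • e)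
    (hf : f ∘ₗ h - h ∘ₗ f = 2 • f)
    (hh : f ∘ₗ e - e ∘ₗ f = h)
    (hirr : ∀ U : Submodule ℂ V,
      (∀ x ∈ U, e x ∈ U) → (∀ x ∈ U, f x ∈ U) → (∀ x ∈ U, h x ∈ U) → U = ⊥ ∨ U = ⊤) :
    ∃ (u : ℕ → V) (b : Module.Basis (Fin (n + 1)) ℂ V),
      (∀ k : Fin (n + 1), b k = u k) ∧ u (n + 1) = 0 ∧
      (∀ k, f (u k) = u (k + 1)) ∧ (∀ k, h (u k) = ((n : ℂ) - 2 * k) • u k) ∧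
      e (u 0) = 0 ∧ ∀ k, e (u (k + 1)) = (-((k + 1) * ((n : ℂ) - k))) • u k := by
  have : Nontrivial V := Module.nontrivial_of_finrank_pos (R := ℂ) (by omega)
  have he (x : V) : h (e x) = e (h x) + (2 : ℂ) • e x := by
    have := LinearMap.congr_fun he x
    simp only [LinearMap.sub_apply, LinearMap.comp_apply, LinearMap.smul_apply] at this
    rw [ofNat_smul_eq_nsmul, ← this]
    abel
  have hf (x : V) : h (f x) = f (h x) - (2 : ℂ) • f x := by
    have := LinearMap.congr_fun hf x
    simp only [LinearMap.sub_apply, LinearMap.comp_apply, LinearMap.smul_apply] at this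
    rw [ofNat_smul_eq_nsmul, ← this]
    abel
  have hh (x : V) : e (f x) = f (e x) - h x := by
    rw [← hh]
    simp
  obtain ⟨v, μ, hv, hev, hhv⟩ := exists_highest_weight_vector e h he
  let u : ℕ → V := fun k => f^[k] v
  have hfu (k : ℕ) : f (u k) = u (k + 1) := (Function.iterate_succ_apply' f k v).symm
  have hhu (k : ℕ) : h (u k) = (μ - 2 * k) • u k := by
    induction k with
    | zero => simpa [u] using hhv
    | succ k ih =>
      rw [← hfu, hf, ih, map_smul, ← sub_smul]
      congr 1
      push_cast
      ring
  have heu (k : ℕ) : e (u (k + 1)) = (-((k + 1) * (μ - k))) • u k := by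
    induction k with
    | zero =>
      rw [← hfu, hh, hhu, show e (u 0) = 0 from hev, map_zero, zero_sub, ← neg_smul]
      congr 1
      push_cast
      ring
    | succ k ih =>
      rw [← hfu, hh, hhu, ih, map_smul, hfu, ← sub_smul]
      congr 1
      push_cast
      ring
  have hspan : Submodule.span ℂ (Set.range u) = ⊤ := by
    have hmem (k : ℕ) : u k ∈ Submodule.span ℂ (Set.range u) := Submodule.subset_span ⟨k, rfl⟩
    have hinv (g : V →ₗ[ℂ] V) (hg : ∀ k, g (u k) ∈ Submodule.span ℂ (Set.range u)) :
        ∀ x ∈ Submodule.span ℂ (Set.range u), g x ∈ Submodule.span ℂ (Set.range u) := by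
      have : Submodule.span ℂ (Set.range u) ≤ (Submodule.span ℂ (Set.range u)).comap g := by
        rw [Submodule.span_le]
        rintro _ ⟨k, rfl⟩
        exact hg k
      exact fun x hx => this hx
    refine (hirr _ (hinv e ?_) (hinv f ?_) (hinv h ?_)).resolve_left fun hbot => ?_
    · rintro (_ | k)
      · rw [show e (u 0) = 0 from hev]
        exact zero_mem _
      · rw [heu]
        exact Submodule.smul_mem _ _ (hmem k)
    · intro k
      rw [hfu]
      exact hmem _
    · intro k
      rw [hhu]
      exact Submodule.smul_mem _ _ (hmem k)
    · exact hv ((Submodule.mem_bot ℂ).mp (hbot ▸ hmem 0))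
  have hzero : ∃ k, u k = 0 :=
    exists_eq_zero_of_arithmetic_weights h μ (-2) (by norm_num) u fun k => by
      rw [hhu]
      ring_nf
  classical
  obtain ⟨N, hN, hmin⟩ : ∃ N, u N = 0 ∧ ∀ k < N, u k ≠ 0 :=
    ⟨Nat.find hzero, Nat.find_spec hzero, fun k => Nat.find_min hzero⟩
  have hge (k : ℕ) (hk : N ≤ k) : u k = 0 := by
    induction k, hk using Nat.le_induction with
    | base => exact hN
    | succ k _ ih => rw [← hfu, ih, map_zero]
  have hli : LinearIndependent ℂ fun k : Fin N => u k :=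
    Module.End.eigenvectors_linearIndependent' h (fun k : Fin N => μ - 2 * (k : ℕ))
      (fun a b hab => by simpa [Fin.ext_iff] using hab) _ fun k =>
      ⟨Module.End.mem_eigenspace_iff.mpr (hhu k), hmin k k.2⟩
  have hspan' : ⊤ ≤ Submodule.span ℂ (Set.range fun k : Fin N => u k) := by
    rw [← hspan, Submodule.span_le]
    rintro _ ⟨k, rfl⟩
    by_cases hk : k < N
    · exact Submodule.subset_span ⟨⟨k, hk⟩, rfl⟩
    · rw [hge k (not_lt.mp hk)]
      exact zero_mem _
  let b := Module.Basis.mk hli hspan'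
  obtain rfl : N = n + 1 := by
    rw [← hdim, Module.finrank_eq_card_basis b, Fintype.card_fin]
  obtain rfl : μ = n := by
    have := heu n
    rw [hN, map_zero, eq_comm, smul_eq_zero_iff_left (hmin n n.lt_succ_self), neg_eq_zero,
      mul_eq_zero, sub_eq_zero] at this
    exact this.resolve_left n.cast_add_one_ne_zero
  exact ⟨u, b, fun k => by simp [b], hN, hfu, hhu, hev, heu⟩

end HighestWeight


/-- Two irreducible su(2)-triples of the same dimension are equivalent. -/
theorem stmt1 (n : ℕ) (V V' : Type*) [AddCommGroup V] [Module ℂ V]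
    [AddCommGroup V'] [Module ℂ V']
    [FiniteDimensional ℂ V] [FiniteDimensional ℂ V']
    (hdim : Module.finrank ℂ V = n + 1) (hdim' : Module.finrank ℂ V' = n + 1)
    (e f h : V →ₗ[ℂ] V) (e' f' h' : V' →ₗ[ℂ] V')
    (he : h ∘ₗ e - e ∘ₗ h = 2 • e)
    (hf : f ∘ₗ h - h ∘ₗ f = 2 • f)
    (hh : f ∘ₗ e - e ∘ₗ f = h)
    (he' : h' ∘ₗ e' - e' ∘ₗ h' = 2 • e')
    (hf' : f' ∘ₗ h' - h' ∘ₗ f' = 2 • f')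
    (hh' : f' ∘ₗ e' - e' ∘ₗ f' = h')
    (hirr : ∀ U : Submodule ℂ V,
      (∀ x ∈ U, e x ∈ U) → (∀ x ∈ U, f x ∈ U) → (∀ x ∈ U, h x ∈ U) →
      U = ⊥ ∨ U = ⊤)
    (hirr' : ∀ U : Submodule ℂ V',
      (∀ x ∈ U, e' x ∈ U) → (∀ x ∈ U, f' x ∈ U) → (∀ x ∈ U, h' x ∈ U) →
      U = ⊥ ∨ U = ⊤) :
    ∃ T : V ≃ₗ[ℂ] V',
      (∀ x : V, T (e x) = e' (T x)) ∧
      (∀ x : V, T (f x) = f' (T x)) ∧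
      (∀ x : V, T (h x) = h' (T x)) := by
  obtain ⟨u, b, hb, hu, hfu, hhu, heu, heu'⟩ := exists_weight_basis n hdim e f h he hf hh hirr
  obtain ⟨w, c, hc, hw, hfw, hhw, hew, hew'⟩ :=
    exists_weight_basis n hdim' e' f' h' he' hf' hh' hirr'
  let T := b.equiv c (Equiv.refl _)
  have hT (k : ℕ) (hk : k < n + 1) : T (u k) = w k := by
    have := b.equiv_apply ⟨k, hk⟩ c (Equiv.refl _)
    rwa [hb, Equiv.refl_apply, hc] at this
  have key (g : V →ₗ[ℂ] V) (g' : V' →ₗ[ℂ] V')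
      (hg : ∀ k < n + 1, T (g (u k)) = g' (w k)) (x : V) : T (g x) = g' (T x) := by
    have : T.toLinearMap ∘ₗ g = g' ∘ₗ T.toLinearMap := b.ext fun k => by
      simpa [hb, hT k k.2] using hg k k.2
    exact LinearMap.congr_fun this x
  refine ⟨T, key e e' ?_, key f f' ?_, key h h' ?_⟩
  · rintro (_ | k) hk
    · rw [heu, hew, map_zero]
    · rw [heu', hew', map_smul, hT k (by omega)]
  · intro k hk
    rw [hfu, hfw]
    obtain hk' | rfl : k + 1 < n + 1 ∨ k = n := by omega
    · exact hT _ hk'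
    · rw [hu, hw, map_zero]
  · intro k hk
    rw [hhu, hhw, map_smul, hT k hk]
end

section
/- Let V be a finite-dimensional complex vector space with linear endomorphisms e, f, h : V → V satisfying h∘e − e∘h = 2e, f∘h − h∘f = 2f, f∘e − e∘f = h. If v ∈ V is an eigenvector of h (i.e. h v = λ·v for some λ ∈ ℂ), then there exists k ∈ ℕ with e^k v = 0, and there exists m ∈ ℕ with f^m v = 0. -/
/-- If `⁅h, g⁆ = c • g`, then `g ^ k` shifts the `h`-eigenvalue of a vector by `k * c`. -/
theorem apply_pow_apply_of_commutator_eq_smul {K V : Type*} [Field K] [AddCommGroup V]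
    [Module K V] {g h : Module.End K V} {c : K} (hc : h * g - g * h = c • g)
    {lam : K} {v : V} (hv : h v = lam • v) (k : ℕ) :
    h ((g ^ k) v) = (lam + k * c) • (g ^ k) v := by
  induction k with
  | zero => simpa using hv
  | succ k ih =>
    have hgk := sub_eq_iff_eq_add.mp (LinearMap.congr_fun hc ((g ^ k) v))
    simp only [Module.End.mul_apply, LinearMap.smul_apply, ih, map_smul] at hgk
    rw [pow_succ', Module.End.mul_apply, hgk]
    push_cast
    module

/-- If `⁅h, g⁆ = c • g` with `c ≠ 0`, then some power of `g` kills any given `h`-eigenvector. -/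
theorem exists_pow_apply_eq_zero_of_commutator_eq_smul {K V : Type*} [Field K] [CharZero K]
    [AddCommGroup V] [Module K V] [FiniteDimensional K V] {g h : Module.End K V} {c : K}
    (hc₀ : c ≠ 0) (hc : h * g - g * h = c • g) {lam : K} {v : V} (hv : h v = lam • v) :
    ∃ k : ℕ, (g ^ k) v = 0 := by
  by_contra! hne
  have hinj : Function.Injective fun k : ℕ => lam + k * c := fun a b hab => by
    simpa [hc₀] using hab
  refine Set.infinite_of_injective_forall_mem hinj (fun k => ?_) h.finite_hasEigenvalue
  exact Module.End.hasEigenvalue_of_hasEigenvector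
    ⟨Module.End.mem_eigenspace_iff.mpr (apply_pow_apply_of_commutator_eq_smul hc hv k), hne k⟩


/-- In finite dimension, e and f act nilpotently on any h-eigenvector. -/
theorem stmt4 (V : Type*) [AddCommGroup V] [Module ℂ V] [FiniteDimensional ℂ V]
    (e f h : V →ₗ[ℂ] V)
    (he : h ∘ₗ e - e ∘ₗ h = 2 • e)
    (hf : f ∘ₗ h - h ∘ₗ f = 2 • f)
    (hh : f ∘ₗ e - e ∘ₗ f = h)
    (v : V) (hv : ∃ lam : ℂ, h v = lam • v) :
    (∃ k : ℕ, (e ^ k) v = 0) ∧ (∃ m : ℕ, (f ^ m) v = 0) := by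
  obtain ⟨lam, hlam⟩ := hv
  refine ⟨exists_pow_apply_eq_zero_of_commutator_eq_smul (c := 2) two_ne_zero ?_ hlam,
    exists_pow_apply_eq_zero_of_commutator_eq_smul (c := -2) (by norm_num) ?_ hlam⟩
  · rw [Module.End.mul_eq_comp, Module.End.mul_eq_comp, he]
    module
  · rw [Module.End.mul_eq_comp, Module.End.mul_eq_comp, ← neg_sub, hf]
    module
end

section
/- Let A be a unital complex star algebra (a unital associative ℂ-algebra with a star-ring involution), let q ∈ ℝ, and let α, γ ∈ A. The 2×2 matrix U = [[α, −q·γ*], [γ, α*]] over A is unitary (that is, U⋆U = 1 and UU⋆ = 1 in M₂(A), where U⋆ denotes the conjugate-transpose matrix [[α*, γ*], [−q·γ, α]]) if and only if the following five relations hold: α*α + γ*γ = 1, αα* + q²·γ*γ = 1, γ*γ = γγ*, αγ = q·γα, and αγ* = q·γ*α. -/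
/-- If `x` is `t`-commuted past `a` and `p`-commuted past `b` with `p` central, where `b * a = 1 - n`
and `a * b = 1 - t ^ 2 • n` for some `n` commuting with `x`, then `p` acts on `x` as the scalar `t`,
provided `t ^ 2 ≠ 1`. -/
theorem central_mul_eq_smul_of_twisted_commute {K A : Type*} [Field K] [Ring A] [Algebra K A]
    {t : K} (ht : t ^ 2 ≠ 1) {p a b n x : A} (hp : ∀ y, p * y = y * p)
    (hba : b * a = 1 - n) (hab : a * b = 1 - t ^ 2 • n) (hn : n * x = x * n)
    (hax : a * x = t • (x * a)) (hxb : x * b = p * (b * x)) : p * x = t • x := by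
  have h₁ : t • (x * (a * b)) = p * ((a * b) * x) := by
    calc t • (x * (a * b)) = (a * x) * b := by rw [hax, smul_mul_assoc, mul_assoc]
      _ = a * (p * (b * x)) := by rw [mul_assoc, hxb]
      _ = p * ((a * b) * x) := by rw [← mul_assoc, ← hp a]; simp only [mul_assoc]
  have h₂ : t • (x * (b * a)) = p * ((b * a) * x) := by
    calc t • (x * (b * a)) = t • ((x * b) * a) := by rw [mul_assoc]
      _ = p * (b * (t • (x * a))) := by
        rw [hxb]; simp only [mul_assoc, mul_smul_comm]
      _ = p * ((b * a) * x) := by rw [← hax, mul_assoc]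
  rw [hab, mul_sub, sub_mul, mul_one, one_mul, mul_smul_comm, smul_mul_assoc, hn,
    mul_sub, mul_smul_comm, smul_sub, smul_comm t (t ^ 2)] at h₁
  rw [hba, mul_sub, sub_mul, mul_one, one_mul, hn, mul_sub, smul_sub] at h₂
  have h₃ : p * x - t • x = p * (x * n) - t • (x * n) := by
    rw [sub_eq_sub_iff_sub_eq_sub, ← h₂]
  have h₄ : p * x - t • x = t ^ 2 • (p * (x * n) - t • (x * n)) := by
    rw [smul_sub, sub_eq_sub_iff_sub_eq_sub, ← h₁]
  have h₅ : (1 - t ^ 2) • (p * x - t • x) = 0 := by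
    rw [sub_smul, one_smul, sub_eq_zero]
    rwa [← h₃] at h₄
  exact sub_eq_zero.mp ((smul_eq_zero.mp h₅).resolve_left (sub_ne_zero.mpr ht.symm))

/-- The defining matrix of SU_q(2) is unitary iff the five Woronowicz relations
hold. -/
theorem stmt10 (A : Type*) [Ring A] [Algebra ℂ A] [StarRing A]
    (q : ℝ) (α γ : A) :
    ((!![star α, star γ; -((q : ℂ) • γ), α] : Matrix (Fin 2) (Fin 2) A) *
        !![α, -((q : ℂ) • star γ); γ, star α] = 1 ∧
      (!![α, -((q : ℂ) • star γ); γ, star α] : Matrix (Fin 2) (Fin 2) A) *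
        !![star α, star γ; -((q : ℂ) • γ), α] = 1) ↔
    (star α * α + star γ * γ = 1 ∧
      α * star α + ((q : ℂ) ^ 2) • (star γ * γ) = 1 ∧
      star γ * γ = γ * star γ ∧
      α * γ = (q : ℂ) • (γ * α) ∧
      α * star γ = (q : ℂ) • (star γ * α)) := by
  have entries (a b c d : A) : (!![a, b; c, d] : Matrix (Fin 2) (Fin 2) A) = 1 ↔
      a = 1 ∧ b = 0 ∧ c = 0 ∧ d = 1 := by
    rw [Matrix.one_fin_two, ← Matrix.ext_iff]
    simp [Fin.forall_fin_two, and_assoc]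
  rw [Matrix.mul_fin_two, Matrix.mul_fin_two, entries, entries]
  simp only [mul_neg, neg_mul, smul_neg, neg_neg, mul_smul_comm, smul_mul_assoc, smul_smul, ← pow_two]
  constructor
  · rintro ⟨⟨h₁, -, h₃, -⟩, k₁, k₂, -, k₄⟩
    refine ⟨h₁, by rw [← k₁], ?_, ?_, ?_⟩
    · rw [add_comm] at h₁
      exact add_right_cancel (h₁.trans k₄.symm)
    · exact (neg_add_eq_zero.mp h₃).symm
    · rwa [← sub_eq_add_neg, sub_eq_zero] at k₂
  · rintro ⟨r₁, r₂, r₃, r₄, r₅⟩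
    set p : A := star (algebraMap ℂ A q) with hp_def
    have hp (y : A) : p * y = y * p := by
      have := congrArg star (Algebra.commutes (q : ℂ) (star y))
      simpa [hp_def] using this.symm
    have star_smul_eq (y : A) : star ((q : ℂ) • y) = p * star y := by
      rw [Algebra.smul_def, star_mul, hp]
    have s₄ : star γ * star α = p * (star α * star γ) := by
      simpa only [star_mul, star_smul_eq] using congrArg star r₄
    have s₅ : γ * star α = p * (star α * γ) := by
      simpa only [star_mul, star_smul_eq, star_star] using congrArg star r₅
    have hγ : p * γ = (q : ℂ) • γ ∧ p * star γ = (q : ℂ) • star γ := by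
      by_cases hq : (q : ℂ) ^ 2 = 1
      · have hpq : p = algebraMap ℂ A q := by
          rcases eq_or_eq_neg_of_sq_eq_sq _ 1 (hq.trans (one_pow 2).symm) with h | h <;> simp [hp_def, h]
        simp [hpq, Algebra.smul_def]
      · have hba := eq_sub_of_add_eq r₁
        have hab := eq_sub_of_add_eq r₂
        exact ⟨central_mul_eq_smul_of_twisted_commute hq hp hba hab
            (by rw [r₃, mul_assoc, r₃]) r₄ s₅,
          central_mul_eq_smul_of_twisted_commute hq hp hba hab
            (by rw [mul_assoc, ← r₃]) r₅ s₄⟩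
    have t₄ : star γ * star α = (q : ℂ) • (star α * star γ) := by
      rw [s₄, ← mul_assoc, hp, mul_assoc, hγ.2, mul_smul_comm]
    have t₅ : γ * star α = (q : ℂ) • (star α * γ) := by
      rw [s₅, ← mul_assoc, hp, mul_assoc, hγ.1, mul_smul_comm]
    refine ⟨⟨r₁, ?_, ?_, ?_⟩, ?_, ?_, ?_, ?_⟩
    · rw [t₄, neg_add_cancel]
    · rw [r₄, neg_add_cancel]
    · rw [← r₃, add_comm, r₂]
    · exact r₂
    · rw [r₅, add_neg_cancel]
    · rw [t₅, add_neg_cancel]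
    · rw [← r₃, add_comm, r₁]
end

section
/- Let q ∈ (0,1) and let H = ℓ²(ℕ × ℤ; ℂ) with standard orthonormal basis (e_{r,s}) for r ∈ ℕ, s ∈ ℤ. There exist bounded linear operators A, C on H such that A e_{0,s} = 0 and A e_{r,s} = √(1 − q^{2r})·e_{r−1,s} for r ≥ 1, C e_{r,s} = q^r·e_{r,s+1}, and such that A*A + C*C = 1, AA* + q²·C*C = 1, C*C = CC*, AC = q·CA, and AC* = q·C*A (where * denotes the Hilbert-space adjoint). -/
/-- The sums of squares of a weighted pullback along an injective map are bounded by the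
`ℓ²` norm, provided that the weights are bounded by `1`. -/
theorem sum_norm_weighted_comp_le {ι : Type*} (w : ι → ℂ) (hw : ∀ i, ‖w i‖ ≤ 1)
    (φ : ι ↪ ι) (f : lp (fun _ : ι => ℂ) 2) (s : Finset ι) :
    ∑ i ∈ s, ‖w i * f (φ i)‖ ^ (2 : ENNReal).toReal ≤ ‖f‖ ^ (2 : ENNReal).toReal := by
  refine le_trans (Finset.sum_le_sum fun i _ => ?_)
    ((Finset.sum_map s φ fun j => ‖f j‖ ^ (2 : ENNReal).toReal).symm.le.trans
      (lp.sum_rpow_le_norm_rpow (by simp) f (s.map φ)))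
  refine Real.rpow_le_rpow (norm_nonneg _) ?_ (by simp)
  rw [norm_mul]
  exact mul_le_of_le_one_left (norm_nonneg _) (hw i)

/-- The weighted composition operator `f ↦ (i ↦ w i * f (φ i))` on `ℓ²`, for weights bounded
by `1` and an injective map `φ`. -/
noncomputable def weightedComp {ι : Type*} (w : ι → ℂ) (hw : ∀ i, ‖w i‖ ≤ 1) (φ : ι ↪ ι) :
    lp (fun _ : ι => ℂ) 2 →L[ℂ] lp (fun _ : ι => ℂ) 2 :=
  LinearMap.mkContinuous
    { toFun := fun f => ⟨fun i => w i * f (φ i),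
        memℓp_gen' (C := ‖f‖ ^ (2 : ENNReal).toReal) (sum_norm_weighted_comp_le w hw φ f)⟩
      map_add' := fun f g => by
        ext i
        exact mul_add _ _ _
      map_smul' := fun c f => by
        ext i
        exact mul_left_comm _ _ _ } 1
    fun f => by
      rw [one_mul]
      exact lp.norm_le_of_forall_sum_le (by simp) (norm_nonneg _)
        (sum_norm_weighted_comp_le w hw φ f)

/-- The coordinates of `T* f` are the inner products of `f` with the images of the basis
vectors. -/
theorem adjoint_apply_eq_inner_single {ι : Type*} [DecidableEq ι]
    (T : lp (fun _ : ι => ℂ) 2 →L[ℂ] lp (fun _ : ι => ℂ) 2) (f : lp (fun _ : ι => ℂ) 2) (i : ι) :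
    ContinuousLinearMap.adjoint T f i = inner ℂ (T (lp.single 2 i 1)) f := by
  rw [← ContinuousLinearMap.adjoint_inner_right, lp.inner_single_left]
  simp

/-- Existence of bounded operators on ℓ²(ℕ × ℤ) realizing the SU_q(2)
relations. -/
theorem stmt11 (q : ℝ) (hq : q ∈ Set.Ioo (0 : ℝ) 1) :
    ∃ A C : lp (fun _ : ℕ × ℤ => ℂ) 2 →L[ℂ] lp (fun _ : ℕ × ℤ => ℂ) 2,
      (∀ s : ℤ, A (lp.single 2 ((0 : ℕ), s) 1) = 0) ∧
      (∀ (r : ℕ) (s : ℤ), A (lp.single 2 (r + 1, s) 1) =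
        ((Real.sqrt (1 - q ^ (2 * (r + 1))) : ℝ) : ℂ) • lp.single 2 (r, s) 1) ∧
      (∀ (r : ℕ) (s : ℤ), C (lp.single 2 (r, s) 1) =
        ((q ^ r : ℝ) : ℂ) • lp.single 2 (r, s + 1) 1) ∧
      ContinuousLinearMap.adjoint A * A + ContinuousLinearMap.adjoint C * C = 1 ∧
      A * ContinuousLinearMap.adjoint A
        + ((q : ℂ) ^ 2) • (ContinuousLinearMap.adjoint C * C) = 1 ∧
      ContinuousLinearMap.adjoint C * C = C * ContinuousLinearMap.adjoint C ∧
      A * C = (q : ℂ) • (C * A) ∧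
      A * ContinuousLinearMap.adjoint C
        = (q : ℂ) • (ContinuousLinearMap.adjoint C * A) := by
  obtain ⟨hq0, hq1⟩ := hq
  have hpow : ∀ n : ℕ, 0 ≤ q ^ n ∧ q ^ n ≤ 1 := fun n =>
    ⟨pow_nonneg hq0.le n, pow_le_one₀ hq0.le hq1.le⟩
  let a : ℕ → ℝ := fun r => Real.sqrt (1 - q ^ (2 * (r + 1)))
  have ha : ∀ r, (a r : ℂ) * a r = 1 - (q : ℂ) ^ (2 * (r + 1)) := fun r => by
    have h := Real.mul_self_sqrt (sub_nonneg.2 (hpow (2 * (r + 1))).2)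
    exact_mod_cast h
  let A := weightedComp (fun i : ℕ × ℤ => (a i.1 : ℂ))
    (fun i => by
      rw [Complex.norm_real, Real.norm_of_nonneg (Real.sqrt_nonneg _), Real.sqrt_le_one]
      linarith [(hpow (2 * (i.1 + 1))).1])
    ⟨fun i => (i.1 + 1, i.2), fun i j h => by simpa [Prod.ext_iff] using h⟩
  let C := weightedComp (fun i : ℕ × ℤ => ((q ^ i.1 : ℝ) : ℂ))
    (fun i => by
      rw [Complex.norm_real, Real.norm_of_nonneg (hpow _).1]
      exact (hpow _).2)
    ⟨fun i => (i.1, i.2 - 1), fun i j h => by simpa [Prod.ext_iff] using h⟩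
  have hA : ∀ f r s, A f (r, s) = a r * f (r + 1, s) := fun f r s => rfl
  have hC : ∀ f r s, C f (r, s) = (q : ℂ) ^ r * f (r, s - 1) := fun f r s => by
    rw [← Complex.ofReal_pow]
    rfl
  have hA0 : ∀ s : ℤ, A (lp.single 2 ((0 : ℕ), s) 1) = 0 := fun s => by
    ext ⟨r, t⟩
    simp [hA]
  have hA1 : ∀ (r : ℕ) (s : ℤ), A (lp.single 2 (r + 1, s) 1) =
      (a r : ℂ) • lp.single 2 (r, s) 1 := fun r s => by
    ext ⟨r', t⟩
    rw [lp.coeFn_smul, Pi.smul_apply, hA, smul_eq_mul]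
    by_cases h : r' = r
    · subst h
      simp [Pi.single_apply]
    · simp [h]
  have hC1 : ∀ (r : ℕ) (s : ℤ), C (lp.single 2 (r, s) 1) =
      ((q ^ r : ℝ) : ℂ) • lp.single 2 (r, s + 1) 1 := fun r s => by
    ext ⟨r', t⟩
    by_cases h : r' = r
    · subst h
      simp [hC, Pi.single_apply, sub_eq_iff_eq_add]
    · simp [hC, h]
  have hA0' : ∀ f s, ContinuousLinearMap.adjoint A f (0, s) = 0 := fun f s => by
    rw [adjoint_apply_eq_inner_single, hA0, inner_zero_left]
  have hA1' : ∀ f r s, ContinuousLinearMap.adjoint A f (r + 1, s) = a r * f (r, s) :=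
    fun f r s => by
      rw [adjoint_apply_eq_inner_single, hA1, inner_smul_left, lp.inner_single_left]
      simp
  have hC' : ∀ f r s, ContinuousLinearMap.adjoint C f (r, s) = (q : ℂ) ^ r * f (r, s + 1) :=
    fun f r s => by
      rw [adjoint_apply_eq_inner_single, hC1, inner_smul_left, lp.inner_single_left]
      simp
  refine ⟨A, C, hA0, hA1, hC1, ?_, ?_, ?_, ?_, ?_⟩ <;> ext f ⟨r, s⟩
  · change ContinuousLinearMap.adjoint A (A f) (r, s)
      + ContinuousLinearMap.adjoint C (C f) (r, s) = f (r, s)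
    rw [hC', hC, add_sub_cancel_right]
    cases r with
    | zero => simp [hA0']
    | succ r =>
      rw [hA1', hA]
      linear_combination f (r + 1, s) * ha r
  · change A (ContinuousLinearMap.adjoint A f) (r, s)
      + (q : ℂ) ^ 2 * ContinuousLinearMap.adjoint C (C f) (r, s) = f (r, s)
    rw [hC', hC, add_sub_cancel_right, hA, hA1']
    linear_combination f (r, s) * ha r
  · change ContinuousLinearMap.adjoint C (C f) (r, s) = C (ContinuousLinearMap.adjoint C f) (r, s)
    rw [hC', hC, hC, hC', add_sub_cancel_right, sub_add_cancel]
  · change A (C f) (r, s) = (q : ℂ) * C (A f) (r, s)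
    rw [hA, hC, hC, hA]
    ring
  · change A (ContinuousLinearMap.adjoint C f) (r, s)
      = (q : ℂ) * ContinuousLinearMap.adjoint C (A f) (r, s)
    rw [hA, hC', hC', hA]
    ring
end

section
/- Let q ∈ (0,1), let H = ℓ²(ℕ × ℤ; ℂ) with standard orthonormal basis (e_{r,s}) for r ∈ ℕ, s ∈ ℤ, and let A, C be bounded linear operators on H with A e_{0,s} = 0, A e_{r,s} = √(1 − q^{2r})·e_{r−1,s} for r ≥ 1, and C e_{r,s} = q^r·e_{r,s+1}. Define, for (k,n,m) ∈ ℤ × ℕ × ℕ, the operator T(k,n,m) = A^k ∘ (C*)^n ∘ C^m if k ≥ 0 and T(k,n,m) = (A*)^{−k} ∘ (C*)^n ∘ C^m if k < 0. Then the family (T(k,n,m))_{(k,n,m) ∈ ℤ × ℕ × ℕ} is linearly independent over ℂ in the space of bounded linear operators on H. -/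
open ContinuousLinearMap in
theorem adjoint_single_apply {ι : Type*} [DecidableEq ι]
    (B : lp (fun _ : ι => ℂ) 2 →L[ℂ] lp (fun _ : ι => ℂ) 2) (i j : ι) :
    adjoint B (lp.single 2 i 1) j = star (B (lp.single 2 j 1) i) := by
  have h := lp.inner_single_left (𝕜 := ℂ) j (1 : ℂ) (adjoint B (lp.single 2 i 1))
  rw [adjoint_inner_right, lp.inner_single_right] at h
  simpa using h.symm

theorem adjoint_lowering_single
    (A : lp (fun _ : ℕ × ℤ => ℂ) 2 →L[ℂ] lp (fun _ : ℕ × ℤ => ℂ) 2) (a : ℕ → ℝ)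
    (hA0 : ∀ s : ℤ, A (lp.single 2 ((0 : ℕ), s) 1) = 0)
    (hA : ∀ (r : ℕ) (s : ℤ), A (lp.single 2 (r + 1, s) 1) =
      (a r : ℂ) • lp.single 2 (r, s) 1) (r : ℕ) (s : ℤ) :
    ContinuousLinearMap.adjoint A (lp.single 2 (r, s) 1) =
      (a r : ℂ) • lp.single 2 (r + 1, s) 1 := by
  ext ⟨r', s'⟩
  rw [adjoint_single_apply]
  cases r' with
  | zero =>
    rw [hA0, lp.coeFn_smul, Pi.smul_apply, lp.single_apply_ne _ _ _ (by simp)]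
    simp
  | succ r' =>
    rw [hA]
    simp only [lp.coeFn_smul, Pi.smul_apply, lp.single_apply, Pi.single_apply, Prod.mk.injEq,
      smul_eq_mul, mul_ite, mul_one, mul_zero, Nat.add_right_cancel_iff]
    by_cases h : r = r' ∧ s = s'
    · obtain ⟨rfl, rfl⟩ := h
      simp
    · rw [if_neg h, if_neg (by grind)]
      simp

theorem adjoint_shift_single
    (C : lp (fun _ : ℕ × ℤ => ℂ) 2 →L[ℂ] lp (fun _ : ℕ × ℤ => ℂ) 2) (c : ℕ → ℝ)
    (hC : ∀ (r : ℕ) (s : ℤ), C (lp.single 2 (r, s) 1) =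
      (c r : ℂ) • lp.single 2 (r, s + 1) 1) (r : ℕ) (s : ℤ) :
    ContinuousLinearMap.adjoint C (lp.single 2 (r, s) 1) =
      (c r : ℂ) • lp.single 2 (r, s - 1) 1 := by
  ext ⟨r', s'⟩
  rw [adjoint_single_apply, hC]
  simp only [lp.coeFn_smul, Pi.smul_apply, lp.single_apply, Pi.single_apply, Prod.mk.injEq,
    smul_eq_mul, mul_ite, mul_one, mul_zero]
  by_cases h : r = r' ∧ s = s' + 1
  · obtain ⟨rfl, rfl⟩ := h
    simp
  · rw [if_neg h, if_neg (by grind)]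
    simp

theorem pow_weighted_single {ι : Type*} [DecidableEq ι]
    (B : lp (fun _ : ι => ℂ) 2 →L[ℂ] lp (fun _ : ι => ℂ) 2) (b : ℕ → ℂ) (f : ℕ → ι)
    (hB : ∀ j, B (lp.single 2 (f j) 1) = b j • lp.single 2 (f (j + 1)) 1) (n : ℕ) :
    (B ^ n) (lp.single 2 (f 0) 1) = (∏ j ∈ Finset.range n, b j) • lp.single 2 (f n) 1 := by
  induction n with
  | zero => simp
  | succ n ih =>
    rw [pow_succ', mul_apply_eq_comp, ih, map_smul, hB, smul_smul,
      Finset.prod_range_succ]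

theorem pow_shift_single
    (C : lp (fun _ : ℕ × ℤ => ℂ) 2 →L[ℂ] lp (fun _ : ℕ × ℤ => ℂ) 2) (c : ℕ → ℂ) (d : ℤ)
    (hC : ∀ (r : ℕ) (s : ℤ), C (lp.single 2 (r, s) 1) = c r • lp.single 2 (r, s + d) 1)
    (n r : ℕ) (s : ℤ) :
    (C ^ n) (lp.single 2 (r, s) 1) = c r ^ n • lp.single 2 (r, s + n * d) 1 := by
  have h := pow_weighted_single C (fun _ => c r) (fun j => (r, s + j * d))
    (fun j => by rw [hC]; congr 3; push_cast; ring) n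
  simpa using h

theorem pow_raising_single
    (B : lp (fun _ : ℕ × ℤ => ℂ) 2 →L[ℂ] lp (fun _ : ℕ × ℤ => ℂ) 2) (a : ℕ → ℂ)
    (hB : ∀ (r : ℕ) (s : ℤ), B (lp.single 2 (r, s) 1) = a r • lp.single 2 (r + 1, s) 1)
    (n r : ℕ) (s : ℤ) :
    (B ^ n) (lp.single 2 (r, s) 1) =
      (∏ j ∈ Finset.range n, a (r + j)) • lp.single 2 (r + n, s) 1 :=
  pow_weighted_single B (fun j => a (r + j)) (fun j => (r + j, s)) (fun j => hB (r + j) s) n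

theorem pow_lowering_single
    (A : lp (fun _ : ℕ × ℤ => ℂ) 2 →L[ℂ] lp (fun _ : ℕ × ℤ => ℂ) 2) (a : ℕ → ℂ)
    (hA : ∀ (r : ℕ) (s : ℤ), A (lp.single 2 (r + 1, s) 1) = a r • lp.single 2 (r, s) 1)
    (n r : ℕ) (s : ℤ) :
    (A ^ n) (lp.single 2 (r + n, s) 1) =
      (∏ j ∈ Finset.range n, a (r + j)) • lp.single 2 (r, s) 1 := by
  induction n with
  | zero => simp
  | succ n ih =>
    rw [pow_succ, mul_apply_eq_comp, ← add_assoc, hA, map_smul, ih, smul_smul,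
      Finset.prod_range_succ, mul_comm]

/-- A family of operators sending, for `r` large, the basis vector at `(r, 0)` to a nonzero
multiple (depending on `k` and `r`) of `x r ^ (n + m)` times the basis vector at
`(r - k, m - n)` is linearly independent. -/
theorem linearIndependent_of_weighted_shift
    (T : ℤ × ℕ × ℕ → lp (fun _ : ℕ × ℤ => ℂ) 2 →L[ℂ] lp (fun _ : ℕ × ℤ => ℂ) 2)
    (w : ℤ → ℕ → ℂ) (x : ℕ → ℂ) (hx : Function.Injective x)
    (hw : ∀ (k : ℤ) (r : ℕ), k ≤ r → w k r ≠ 0)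
    (hT : ∀ (k : ℤ) (n m r : ℕ), k ≤ r → T (k, n, m) (lp.single 2 (r, 0) 1) =
      (w k r * x r ^ (n + m)) • lp.single 2 (((r : ℤ) - k).toNat, (m : ℤ) - n) 1) :
    LinearIndependent ℂ T := by
  classical
  rw [linearIndependent_iff']
  rintro S g hg ⟨k, n, m⟩ hp
  set F := S.filter fun p => p.1 = k ∧ (p.2.2 : ℤ) - p.2.1 = m - n with hF
  set P : Polynomial ℂ := ∑ p ∈ F, Polynomial.monomial (p.2.1 + p.2.2) (g p) with hP
  have hroot : ∀ r ≥ S.sup fun p => p.1.toNat, P.IsRoot (x r) := by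
    intro r hr
    have hle : ∀ p ∈ S, p.1 ≤ r := fun p hpS => by
      have := (Finset.le_sup (f := fun p : ℤ × ℕ × ℕ => p.1.toNat) hpS).trans hr
      omega
    have h : (∑ p ∈ S, g p • T p) (lp.single 2 (r, 0) 1)
        (((r : ℤ) - k).toNat, (m : ℤ) - n) = 0 := by
      rw [hg]; rfl
    have hsum : ∑ p ∈ S, (if p.1 = k ∧ (p.2.2 : ℤ) - p.2.1 = m - n then
        w k r * (g p * x r ^ (p.2.1 + p.2.2)) else 0) = 0 := by
      refine Eq.trans ?_ h
      rw [_root_.sum_apply, lp.coeFn_sum, Finset.sum_apply]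
      refine Finset.sum_congr rfl fun p hpS => ?_
      obtain ⟨k', n', m'⟩ := p
      have h1 : k' ≤ r := hle _ hpS
      have h2 : k ≤ r := hle _ hp
      rw [_root_.smul_apply, hT _ _ _ _ h1]
      simp only [lp.coeFn_smul, Pi.smul_apply, lp.single_apply, Pi.single_apply, Prod.mk.injEq,
        smul_eq_mul, mul_ite, mul_one, mul_zero]
      split_ifs with h3 h4 h4
      · obtain ⟨rfl, -⟩ := h3
        ring
      · exact absurd ⟨by omega, by omega⟩ h4
      · exact absurd ⟨by omega, by omega⟩ h3
      · rfl
    rw [← Finset.sum_filter, ← Finset.mul_sum] at hsum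
    have := (mul_eq_zero.mp hsum).resolve_left (hw k r (hle _ hp))
    simpa [Polynomial.IsRoot, hP, Polynomial.eval_finsetSum, Polynomial.eval_monomial] using this
  have hP0 : P = 0 := by
    refine Polynomial.eq_zero_of_infinite_isRoot P (Set.Infinite.mono ?_
      ((Set.Ici_infinite (S.sup fun p => p.1.toNat)).image hx.injOn))
    rintro _ ⟨r, hr, rfl⟩
    exact hroot r hr
  have hcoeff : P.coeff (n + m) = g (k, n, m) := by
    rw [hP, Polynomial.finsetSum_coeff, Finset.sum_eq_single_of_mem (k, n, m)]
    · simp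
    · simp [hF, hp]
    · rintro ⟨k', n', m'⟩ hpF hne
      rw [Polynomial.coeff_monomial, if_neg]
      intro h
      rw [hF, Finset.mem_filter] at hpF
      refine hne ?_
      obtain ⟨-, h1, h2⟩ := hpF
      simp only at h h1 h2
      simp only [Prod.mk.injEq]
      omega
  rw [← hcoeff, hP0, Polynomial.coeff_zero]

/-- Linear independence of the family A^k C*^n C^m of bounded operators on
ℓ²(ℕ × ℤ). -/
theorem stmt12 (q : ℝ) (hq : q ∈ Set.Ioo (0 : ℝ) 1)
    (A C : lp (fun _ : ℕ × ℤ => ℂ) 2 →L[ℂ] lp (fun _ : ℕ × ℤ => ℂ) 2)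
    (hA0 : ∀ s : ℤ, A (lp.single 2 ((0 : ℕ), s) 1) = 0)
    (hA : ∀ (r : ℕ) (s : ℤ), A (lp.single 2 (r + 1, s) 1) =
      ((Real.sqrt (1 - q ^ (2 * (r + 1))) : ℝ) : ℂ) • lp.single 2 (r, s) 1)
    (hC : ∀ (r : ℕ) (s : ℤ), C (lp.single 2 (r, s) 1) =
      ((q ^ r : ℝ) : ℂ) • lp.single 2 (r, s + 1) 1) :
    LinearIndependent ℂ (fun p : ℤ × ℕ × ℕ =>
      if 0 ≤ p.1 then
        A ^ p.1.toNat * ContinuousLinearMap.adjoint C ^ p.2.1 * C ^ p.2.2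
      else
        ContinuousLinearMap.adjoint A ^ (-p.1).toNat
          * ContinuousLinearMap.adjoint C ^ p.2.1 * C ^ p.2.2) := by
  have hq0 := hq.1
  have hq1 := hq.2
  set a : ℕ → ℝ := fun r => Real.sqrt (1 - q ^ (2 * (r + 1)))
  have ha0 : ∀ r, (a r : ℂ) ≠ 0 := fun r => by
    rw [Complex.ofReal_ne_zero]
    exact (Real.sqrt_pos.mpr (sub_pos.mpr (pow_lt_one₀ hq0.le hq1 (by omega)))).ne'
  have hA' := adjoint_lowering_single A a hA0 hA
  have hC' := adjoint_shift_single C (fun r => q ^ r) hC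
  have hCC : ∀ (n m r : ℕ), (ContinuousLinearMap.adjoint C ^ n)
      ((C ^ m) (lp.single 2 (r, (0 : ℤ)) 1)) =
        ((q ^ r : ℝ) : ℂ) ^ (n + m) • lp.single 2 (r, (m : ℤ) - n) 1 := by
    intro n m r
    rw [pow_shift_single C (fun r => ((q ^ r : ℝ) : ℂ)) 1 hC, map_smul,
      pow_shift_single _ (fun r => ((q ^ r : ℝ) : ℂ)) (-1) hC', smul_smul, pow_add, mul_comm]
    congr 3
    ring
  refine linearIndependent_of_weighted_shift _
    (fun k r => if 0 ≤ k then ∏ j ∈ Finset.range k.toNat, (a (r - k.toNat + j) : ℂ)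
      else ∏ j ∈ Finset.range (-k).toNat, (a (r + j) : ℂ))
    (fun r => ((q ^ r : ℝ) : ℂ))
    (Complex.ofReal_injective.comp (pow_right_injective₀ hq0 hq1.ne)) ?_ ?_
  · intro k r _
    split_ifs <;> exact Finset.prod_ne_zero_iff.mpr fun j _ => ha0 _
  · intro k n m r hkr
    split_ifs with hk
    · obtain ⟨r, rfl⟩ : ∃ r', r = r' + k.toNat := ⟨r - k.toNat, by omega⟩
      rw [mul_assoc, mul_apply_eq_comp, mul_apply_eq_comp, hCC, map_smul,
        pow_lowering_single A (fun r => (a r : ℂ)) hA, smul_smul, mul_comm, Nat.add_sub_cancel]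
      congr 3
      omega
    · rw [mul_assoc, mul_apply_eq_comp, mul_apply_eq_comp, hCC, map_smul,
        pow_raising_single _ (fun r => (a r : ℂ)) hA', smul_smul, mul_comm]
      congr 3
      omega
end

section
/- Let q ∈ (0,1), n ∈ ℕ, and let (A₀, A₁, A₂) and (A₀', A₁', A₂') be two irreducible infinitesimal representations of SU_q(2) on ℂ^{n+1}, i.e. two triples of linear operators on ℂ^{n+1} each satisfying q·A₂A₀ − q⁻¹·A₀A₂ = A₁, q²·A₁A₀ − q⁻²·A₀A₁ = (1+q²)·A₀, A₂ = −q·A₀*, A₁* = A₁, such that the only orthogonal projections commuting with the triple are 0 and the identity. Then the two triples are unitarily equivalent: there exists a unitary operator W on ℂ^{n+1} with W A₀ = A₀' W, W A₁ = A₁' W and W A₂ = A₂' W. -/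
namespace InfinitesimalSUq

open ContinuousLinearMap Module
open scoped InnerProductSpace

/-- The eigenvalues of `A₁` along a ladder starting at the eigenvalue `μ`. -/
noncomputable def weight (q μ : ℂ) : ℕ → ℂ
  | 0 => μ
  | j + 1 => q ^ 4 * weight q μ j - q ^ 2 * (1 + q ^ 2)

/-- The coefficients with which `A₀` moves down a ladder starting at the eigenvalue `μ`. -/
noncomputable def coeff (q μ : ℂ) : ℕ → ℂ
  | 0 => 0
  | j + 1 => weight q μ j + q ^ 2 * coeff q μ j

lemma weight_sub (q μ ν : ℂ) (j : ℕ) :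
    weight q μ j - weight q ν j = (q ^ 4) ^ j * (μ - ν) := by
  induction j with
  | zero => simp [weight]
  | succ j ih => simp only [weight]; rw [pow_succ]; linear_combination q ^ 4 * ih

lemma coeff_succ_sub {q : ℝ} (hq : 0 < q) (μ ν : ℂ) (j : ℕ) :
    ∃ t : ℝ, 0 < t ∧ coeff q μ (j + 1) - coeff q ν (j + 1) = t * (μ - ν) := by
  induction j with
  | zero => exact ⟨1, one_pos, by simp [coeff, weight]⟩
  | succ j ih =>
    obtain ⟨t, ht, h⟩ := ih
    refine ⟨(q ^ 4) ^ (j + 1) + q ^ 2 * t, by positivity, ?_⟩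
    rw [coeff, coeff.eq_def _ ν]
    push_cast
    linear_combination weight_sub (q : ℂ) μ ν (j + 1) + (q : ℂ) ^ 2 * h

lemma eq_of_coeff_succ_eq {q : ℝ} (hq : 0 < q) {μ ν : ℂ} {j : ℕ}
    (h : coeff q μ (j + 1) = coeff q ν (j + 1)) : μ = ν := by
  obtain ⟨t, ht, h'⟩ := coeff_succ_sub hq μ ν j
  rw [h, sub_self, eq_comm, mul_eq_zero, Complex.ofReal_eq_zero, sub_eq_zero] at h'
  exact h'.resolve_left ht.ne'

lemma pow_apply_eq_zero_of_le {E : Type*} [NormedAddCommGroup E] [InnerProductSpace ℂ E]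
    {T : E →L[ℂ] E} {x : E} {i j : ℕ}
    (hij : i ≤ j)
    (h : (T ^ i) x = 0) : (T ^ j) x = 0 := by
  obtain ⟨k, rfl⟩ := Nat.exists_eq_add_of_le' hij
  rw [pow_add, mul_apply_eq_comp, h, map_zero]

variable {E : Type*} [NormedAddCommGroup E] [InnerProductSpace ℂ E] [FiniteDimensional ℂ E]

lemma ker_ne_bot [Nontrivial E] {q : ℝ} (hq : q ∈ Set.Ioo (0 : ℝ) 1) {A A₁ : E →L[ℂ] E}
    (h₁ : A₁ = A * adjoint A - (q : ℂ) ^ 2 • (adjoint A * A))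
    (h₂ : ((q : ℂ) ^ 2) • (A₁ * A) - ((q : ℂ) ^ 2)⁻¹ • (A * A₁) = (1 + (q : ℂ) ^ 2) • A) :
    LinearMap.ker (A : E →ₗ[ℂ] E) ≠ ⊥ := by
  intro hker
  obtain ⟨u, hu⟩ := (LinearMap.isUnit_iff_ker_eq_bot (A : E →ₗ[ℂ] E)).2 hker
  have hur : (A : E →ₗ[ℂ] E) * (↑u⁻¹ : E →ₗ[ℂ] E) = 1 := by rw [← hu]; exact u.mul_inv
  have hru : (↑u⁻¹ : E →ₗ[ℂ] E) * (A : E →ₗ[ℂ] E) = 1 := by rw [← hu]; exact u.inv_mul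
  set a : E →ₗ[ℂ] E := (A : E →ₗ[ℂ] E)
  set r : E →ₗ[ℂ] E := (↑u⁻¹ : E →ₗ[ℂ] E)
  set s : E →ₗ[ℂ] E := (adjoint A : E →ₗ[ℂ] E)
  have h₁' : (A₁ : E →ₗ[ℂ] E) = a * s - (q : ℂ) ^ 2 • (s * a) := by rw [h₁]; rfl
  set a₁ : E →ₗ[ℂ] E := (A₁ : E →ₗ[ℂ] E)
  have h₂' : ((q : ℂ) ^ 2) • (a₁ * a) - ((q : ℂ) ^ 2)⁻¹ • (a * a₁) = (1 + (q : ℂ) ^ 2) • a :=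
    congrArg (fun T : E →L[ℂ] E => (T : E →ₗ[ℂ] E)) h₂
  have h₃ : ((q : ℂ) ^ 2) • a₁ - ((q : ℂ) ^ 2)⁻¹ • (a * a₁ * r) = (1 + (q : ℂ) ^ 2) • 1 := by
    have := congrArg (· * r) h₂'
    simpa only [sub_mul, smul_mul_assoc, mul_assoc, hur, mul_one] using this
  have h₄ := congrArg (LinearMap.trace ℂ E) h₃
  have hcyc : LinearMap.trace ℂ E (a * a₁ * r) = LinearMap.trace ℂ E a₁ := by
    rw [LinearMap.trace_mul_comm, ← mul_assoc, hru, one_mul]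
  have ht : LinearMap.trace ℂ E (s * a) =
      ((∑ i, ‖A (stdOrthonormalBasis ℂ E i)‖ ^ 2 : ℝ) : ℂ) := by
    rw [LinearMap.trace_eq_sum_inner _ (stdOrthonormalBasis ℂ E)]
    push_cast
    refine Finset.sum_congr rfl fun i _ => ?_
    change ⟪_, adjoint A (A _)⟫_ℂ = _
    rw [adjoint_inner_right, inner_self_eq_norm_sq_to_K]
    rfl
  have hx : 0 ≤ ∑ i, ‖A (stdOrthonormalBasis ℂ E i)‖ ^ 2 := by positivity
  have ht₁ : LinearMap.trace ℂ E a₁ = (1 - (q : ℂ) ^ 2) * LinearMap.trace ℂ E (s * a) := by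
    rw [h₁', map_sub, map_smul, LinearMap.trace_mul_comm ℂ a s, smul_eq_mul]; ring
  rw [map_sub, map_smul, map_smul, map_smul, hcyc, ht₁, ht, LinearMap.trace_one] at h₄
  set x := ∑ i, ‖A (stdOrthonormalBasis ℂ E i)‖ ^ 2
  simp only [smul_eq_mul] at h₄
  have h₅ : q ^ 2 * ((1 - q ^ 2) * x) - (q ^ 2)⁻¹ * ((1 - q ^ 2) * x) =
      (1 + q ^ 2) * (finrank ℂ E : ℝ) := by exact_mod_cast h₄
  have hd : (0 : ℝ) < finrank ℂ E := by exact_mod_cast finrank_pos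
  obtain ⟨hq0, hq1⟩ := hq
  have hq2 : q ^ 2 < 1 := by nlinarith
  have hinv : 1 < (q ^ 2)⁻¹ := (one_lt_inv₀ (by positivity)).2 hq2
  have : 0 ≤ ((q ^ 2)⁻¹ - q ^ 2) * ((1 - q ^ 2) * x) :=
    mul_nonneg (by linarith) (mul_nonneg (by linarith) hx)
  have : 0 < (1 + q ^ 2) * (finrank ℂ E : ℝ) := by positivity
  linarith

/-- There is a unit lowest-weight vector. -/
lemma exists_lowest [Nontrivial E] {q : ℝ} (hq : q ∈ Set.Ioo (0 : ℝ) 1) {A A₁ : E →L[ℂ] E}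
    (h₁ : A₁ = A * adjoint A - (q : ℂ) ^ 2 • (adjoint A * A))
    (h₂ : ((q : ℂ) ^ 2) • (A₁ * A) - ((q : ℂ) ^ 2)⁻¹ • (A * A₁) = (1 + (q : ℂ) ^ 2) • A) :
    ∃ (μ : ℂ) (v : E), ‖v‖ = 1 ∧ A v = 0 ∧ A₁ v = μ • v := by
  have hq0 : (q : ℂ) ^ 2 ≠ 0 := pow_ne_zero _ (Complex.ofReal_ne_zero.2 hq.1.ne')
  have hinv : ∀ x ∈ LinearMap.ker (A : E →ₗ[ℂ] E),
      (A₁ : E →ₗ[ℂ] E) x ∈ LinearMap.ker (A : E →ₗ[ℂ] E) := by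
    intro x hx
    have hx' : A x = 0 := hx
    have h := congrArg (fun T : E →L[ℂ] E => T x) h₂
    simp only [sub_apply, smul_apply, mul_apply_eq_comp, hx', map_zero, smul_zero, zero_sub,
      neg_eq_zero, smul_eq_zero, inv_eq_zero, hq0, false_or] at h
    exact h
  have : Nontrivial (LinearMap.ker (A : E →ₗ[ℂ] E)) :=
    Submodule.nontrivial_iff_ne_bot.2 (ker_ne_bot hq h₁ h₂)
  obtain ⟨μ, hμ⟩ := Module.End.exists_eigenvalue ((A₁ : E →ₗ[ℂ] E).restrict hinv)
  obtain ⟨x, hx⟩ := hμ.exists_hasEigenvector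
  have hxμ : A₁ (x : E) = μ • (x : E) := congrArg Subtype.val hx.apply_eq_smul
  have hx0 : (x : E) ≠ 0 := fun h => hx.2 (Subtype.ext h)
  have hAx : A (x : E) = 0 := x.2
  refine ⟨μ, ((‖(x : E)‖ : ℂ)⁻¹) • (x : E), norm_smul_inv_norm hx0, ?_, ?_⟩
  · rw [map_smul, hAx, smul_zero]
  · rw [map_smul, hxμ, smul_comm]

lemma adjoint_relation {q : ℝ} {A A₁ : E →L[ℂ] E} (hs : adjoint A₁ = A₁)
    (h₂ : ((q : ℂ) ^ 2) • (A₁ * A) - ((q : ℂ) ^ 2)⁻¹ • (A * A₁) = (1 + (q : ℂ) ^ 2) • A) :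
    ((q : ℂ) ^ 2) • (adjoint A * A₁) - ((q : ℂ) ^ 2)⁻¹ • (A₁ * adjoint A) =
      (1 + (q : ℂ) ^ 2) • adjoint A := by
  have h := congrArg star h₂
  simp only [star_sub, star_smul, star_mul, star_eq_adjoint, hs, star_add, star_one, star_pow,
    star_inv₀, Complex.star_def, Complex.conj_ofReal] at h
  exact h

lemma ladder_aux {q : ℝ} (hq : q ≠ 0) {A A₁ : E →L[ℂ] E} (hs : adjoint A₁ = A₁)
    (h₁ : A₁ = A * adjoint A - (q : ℂ) ^ 2 • (adjoint A * A))
    (h₂ : ((q : ℂ) ^ 2) • (A₁ * A) - ((q : ℂ) ^ 2)⁻¹ • (A * A₁) = (1 + (q : ℂ) ^ 2) • A)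
    {μ : ℂ} {v : E} (hv : A v = 0) (hμ : A₁ v = μ • v) (j : ℕ) :
    A₁ ((adjoint A ^ j) v) = weight q μ j • (adjoint A ^ j) v ∧
      adjoint A (A ((adjoint A ^ j) v)) = coeff q μ j • (adjoint A ^ j) v ∧
      A ((adjoint A ^ (j + 1)) v) = coeff q μ (j + 1) • (adjoint A ^ j) v := by
  have hq0 : (q : ℂ) ≠ 0 := Complex.ofReal_ne_zero.2 hq
  have step : ∀ x : E, A (adjoint A x) = A₁ x + (q : ℂ) ^ 2 • adjoint A (A x) := fun x => by
    rw [h₁]; simp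
  have down : ∀ x : E, A₁ (adjoint A x) =
      ((q : ℂ) ^ 4) • adjoint A (A₁ x) - ((q : ℂ) ^ 2 * (1 + (q : ℂ) ^ 2)) • adjoint A x := by
    intro x
    have h := congrArg (fun T : E →L[ℂ] E => (q : ℂ) ^ 2 • T x) (adjoint_relation hs h₂)
    simp only [sub_apply, smul_apply, mul_apply_eq_comp, smul_sub, smul_smul] at h
    rw [mul_inv_cancel₀ (pow_ne_zero 2 hq0), one_smul, ← pow_add] at h
    rw [← h]; abel
  have key : ∀ j, A₁ ((adjoint A ^ j) v) = weight q μ j • (adjoint A ^ j) v ∧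
      adjoint A (A ((adjoint A ^ j) v)) = coeff q μ j • (adjoint A ^ j) v →
      A ((adjoint A ^ (j + 1)) v) = coeff q μ (j + 1) • (adjoint A ^ j) v := by
    rintro j ⟨hw, hc⟩
    rw [pow_succ', mul_apply_eq_comp, step, hw, hc, smul_smul, ← add_smul, coeff]
  have main : A₁ ((adjoint A ^ j) v) = weight q μ j • (adjoint A ^ j) v ∧
      adjoint A (A ((adjoint A ^ j) v)) = coeff q μ j • (adjoint A ^ j) v := by
    induction j with
    | zero => simp [weight, coeff, hv, hμ]
    | succ j ih =>
      constructor
      · rw [pow_succ', mul_apply_eq_comp, down, ih.1, map_smul, smul_smul, ← sub_smul, weight]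
      · rw [key j ih, map_smul, pow_succ', mul_apply_eq_comp]
  exact ⟨main.1, main.2, key j main⟩

section Ladder

variable {A : E →L[ℂ] E} {v : E} {c : ℕ → ℂ}

lemma inner_ladder_of_lt (hv : A v = 0)
    (hc : ∀ j, A ((adjoint A ^ (j + 1)) v) = c j • (adjoint A ^ j) v) {i j : ℕ} (hij : i < j) :
    ⟪(adjoint A ^ i) v, (adjoint A ^ j) v⟫_ℂ = 0 := by
  induction i generalizing j with
  | zero =>
    obtain ⟨k, rfl⟩ := Nat.exists_eq_succ_of_ne_zero hij.ne'
    rw [pow_succ', mul_apply_eq_comp, adjoint_inner_right, pow_zero,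
      one_apply_eq_self, hv, inner_zero_left]
  | succ i ih =>
    obtain ⟨k, rfl⟩ := Nat.exists_eq_succ_of_ne_zero (by omega : j ≠ 0)
    rw [Nat.succ_eq_add_one, pow_succ' _ k, mul_apply_eq_comp, adjoint_inner_right, hc,
      inner_smul_left, ih (by omega), mul_zero]

lemma inner_ladder_of_ne (hv : A v = 0)
    (hc : ∀ j, A ((adjoint A ^ (j + 1)) v) = c j • (adjoint A ^ j) v) {i j : ℕ} (hij : i ≠ j) :
    ⟪(adjoint A ^ i) v, (adjoint A ^ j) v⟫_ℂ = 0 := by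
  rcases hij.lt_or_gt with h | h
  · exact inner_ladder_of_lt hv hc h
  · exact inner_eq_zero_symm.1 (inner_ladder_of_lt hv hc h)

lemma norm_sq_ladder_succ
    (hc : ∀ j, A ((adjoint A ^ (j + 1)) v) = c j • (adjoint A ^ j) v) (j : ℕ) :
    ‖(adjoint A ^ (j + 1)) v‖ ^ 2 = (c j).re * ‖(adjoint A ^ j) v‖ ^ 2 := by
  have h : ⟪(adjoint A ^ (j + 1)) v, (adjoint A ^ (j + 1)) v⟫_ℂ =
      starRingEnd ℂ (c j) * ⟪(adjoint A ^ j) v, (adjoint A ^ j) v⟫_ℂ := by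
    nth_rewrite 2 [pow_succ']
    rw [mul_apply_eq_comp, adjoint_inner_right, hc, inner_smul_left]
  rw [inner_self_eq_norm_sq_to_K, inner_self_eq_norm_sq_to_K] at h
  have h' := congrArg Complex.re h
  simp only [Complex.coe_algebraMap, ← Complex.ofReal_pow, Complex.re_mul_ofReal,
    Complex.ofReal_re, Complex.conj_re] at h'
  exact h'

lemma norm_ladder_eq {B : E →L[ℂ] E} {w : E} (hvw : ‖v‖ = ‖w‖)
    (hA : ∀ j, A ((adjoint A ^ (j + 1)) v) = c j • (adjoint A ^ j) v)
    (hB : ∀ j, B ((adjoint B ^ (j + 1)) w) = c j • (adjoint B ^ j) w) (j : ℕ) :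
    ‖(adjoint A ^ j) v‖ = ‖(adjoint B ^ j) w‖ := by
  induction j with
  | zero => simpa using hvw
  | succ j ih =>
    refine (sq_eq_sq₀ (norm_nonneg _) (norm_nonneg _)).1 ?_
    rw [norm_sq_ladder_succ hA, norm_sq_ladder_succ hB, ih]

/-- A subspace that reduces an irreducible operator is trivial. -/
lemma eq_bot_or_eq_top_of_irreducible
    (hirr : ∀ P : E →L[ℂ] E, P * P = P → adjoint P = P → P * A = A * P → P = 0 ∨ P = 1)
    {V : Submodule ℂ E} (hA : ∀ x ∈ V, A x ∈ V) (hS : ∀ x ∈ V, adjoint A x ∈ V) :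
    V = ⊥ ∨ V = ⊤ := by
  have hcomm : V.starProjection * A = A * V.starProjection := by
    ext x
    rw [mul_apply_eq_comp, mul_apply_eq_comp]
    refine Submodule.eq_starProjection_of_mem_of_inner_eq_zero
      (hA _ (Submodule.starProjection_apply_mem V x)) fun w hw => ?_
    rw [← map_sub, ← adjoint_inner_right]
    exact Submodule.starProjection_inner_eq_zero x _ (hS w hw)
  rcases hirr _ V.isIdempotentElem_starProjection (isSelfAdjoint_starProjection V) hcomm with h | h
  · left
    rw [← Submodule.range_starProjection V, h]
    exact LinearMap.range_zero
  · right
    rw [← Submodule.range_starProjection V, h]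
    exact LinearMap.range_id

lemma span_ladder_eq_top
    (hirr : ∀ P : E →L[ℂ] E, P * P = P → adjoint P = P → P * A = A * P → P = 0 ∨ P = 1)
    (hv0 : v ≠ 0) (hv : A v = 0)
    (hc : ∀ j, A ((adjoint A ^ (j + 1)) v) = c j • (adjoint A ^ j) v) :
    Submodule.span ℂ (Set.range fun j : ℕ => (adjoint A ^ j) v) = ⊤ := by
  have hmem : ∀ j, (adjoint A ^ j) v ∈
      Submodule.span ℂ (Set.range fun j : ℕ => (adjoint A ^ j) v) :=
    fun j => Submodule.subset_span ⟨j, rfl⟩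
  refine (eq_bot_or_eq_top_of_irreducible hirr (fun x hx => ?_) fun x hx => ?_).resolve_left ?_
  · induction hx using Submodule.span_induction with
    | mem x hx =>
      obtain ⟨j, rfl⟩ := hx
      cases j with
      | zero => simp [hv]
      | succ j => simp only [hc]; exact Submodule.smul_mem _ _ (hmem j)
    | zero => simp
    | add x y _ _ hx hy => rw [map_add]; exact Submodule.add_mem _ hx hy
    | smul a x _ hx => rw [map_smul]; exact Submodule.smul_mem _ _ hx
  · induction hx using Submodule.span_induction with
    | mem x hx =>
      obtain ⟨j, rfl⟩ := hx
      have := hmem (j + 1)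
      rwa [pow_succ', mul_apply_eq_comp] at this
    | zero => simp
    | add x y _ _ hx hy => rw [map_add]; exact Submodule.add_mem _ hx hy
    | smul a x _ hx => rw [map_smul]; exact Submodule.smul_mem _ _ hx
  · intro h
    have := hmem 0
    rw [h, Submodule.mem_bot] at this
    exact hv0 (by simpa using this)

lemma ladder_eq_zero_iff {d : ℕ} (hd : finrank ℂ E = d)
    (hirr : ∀ P : E →L[ℂ] E, P * P = P → adjoint P = P → P * A = A * P → P = 0 ∨ P = 1)
    (hv0 : v ≠ 0) (hv : A v = 0)
    (hc : ∀ j, A ((adjoint A ^ (j + 1)) v) = c j • (adjoint A ^ j) v) (j : ℕ) :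
    (adjoint A ^ j) v = 0 ↔ d ≤ j := by
  constructor
  · intro h
    have hspan : Submodule.span ℂ (Set.range fun i : Fin j => (adjoint A ^ (i : ℕ)) v) = ⊤ := by
      rw [eq_top_iff, ← span_ladder_eq_top hirr hv0 hv hc, Submodule.span_le]
      rintro _ ⟨k, rfl⟩
      rcases lt_or_ge k j with hk | hk
      · exact Submodule.subset_span ⟨⟨k, hk⟩, rfl⟩
      · simp only [pow_apply_eq_zero_of_le hk h]
        exact Submodule.zero_mem _
    have := finrank_range_le_card (R := ℂ) fun i : Fin j => (adjoint A ^ (i : ℕ)) v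
    rwa [Set.finrank, hspan, finrank_top, hd, Fintype.card_fin] at this
  · intro hj
    refine pow_apply_eq_zero_of_le hj ?_
    by_contra hne
    have hli : LinearIndependent ℂ fun i : Fin (d + 1) => (adjoint A ^ (i : ℕ)) v :=
      linearIndependent_of_ne_zero_of_inner_eq_zero
        (fun i h => hne (pow_apply_eq_zero_of_le (Nat.lt_succ_iff.1 i.2) h))
        fun i k hik => inner_ladder_of_ne hv hc fun h => hik (Fin.ext h)
    have := hli.fintype_card_le_finrank
    rw [Fintype.card_fin, hd] at this
    omega

/-- The normalised ladder is an orthonormal basis. -/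
lemma exists_orthonormalBasis_ladder {d : ℕ} [NeZero d] (hd : finrank ℂ E = d)
    (hv : A v = 0) (hc : ∀ j, A ((adjoint A ^ (j + 1)) v) = c j • (adjoint A ^ j) v)
    (h0 : ∀ j, (adjoint A ^ j) v = 0 ↔ d ≤ j) :
    ∃ b : OrthonormalBasis (Fin d) ℂ E,
      ∀ j : Fin d, (adjoint A ^ (j : ℕ)) v = (‖(adjoint A ^ (j : ℕ)) v‖ : ℂ) • b j := by
  have hne : ∀ j : Fin d, (adjoint A ^ (j : ℕ)) v ≠ 0 := fun j h => by
    have := (h0 j).1 h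
    omega
  have hon : Orthonormal ℂ fun j : Fin d =>
      ((‖(adjoint A ^ (j : ℕ)) v‖ : ℂ)⁻¹) • (adjoint A ^ (j : ℕ)) v := by
    refine ⟨fun j => norm_smul_inv_norm (hne j), fun i j hij => ?_⟩
    beta_reduce
    rw [inner_smul_left, inner_smul_right,
      inner_ladder_of_ne hv hc fun h => hij (Fin.ext h), mul_zero, mul_zero]
  have hcard : Fintype.card (Fin d) = finrank ℂ E := by rw [hd, Fintype.card_fin]
  have hb := coe_basisOfOrthonormalOfCardEqFinrank hon hcard
  refine ⟨(basisOfOrthonormalOfCardEqFinrank hon hcard).toOrthonormalBasis (by rwa [hb]),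
    fun j => ?_⟩
  rw [Module.Basis.coe_toOrthonormalBasis, hb, smul_smul, mul_inv_cancel₀, one_smul]
  exact Complex.ofReal_ne_zero.2 (norm_ne_zero_iff.2 (hne j))

lemma exists_isometry_of_ladders {d : ℕ} [NeZero d] (hd : finrank ℂ E = d)
    {B : E →L[ℂ] E} {w : E} (hvw : ‖v‖ = ‖w‖) (hv : A v = 0) (hw : B w = 0)
    (hA : ∀ j, A ((adjoint A ^ (j + 1)) v) = c j • (adjoint A ^ j) v)
    (hB : ∀ j, B ((adjoint B ^ (j + 1)) w) = c j • (adjoint B ^ j) w)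
    (hA0 : ∀ j, (adjoint A ^ j) v = 0 ↔ d ≤ j) (hB0 : ∀ j, (adjoint B ^ j) w = 0 ↔ d ≤ j) :
    ∃ W : E ≃ₗᵢ[ℂ] E, (∀ x, W (A x) = B (W x)) ∧ ∀ x, W (adjoint A x) = adjoint B (W x) := by
  obtain ⟨b, hb⟩ := exists_orthonormalBasis_ladder hd hv hA hA0
  obtain ⟨b', hb'⟩ := exists_orthonormalBasis_ladder hd hw hB hB0
  let W : E ≃ₗᵢ[ℂ] E := b.equiv b' (Equiv.refl _)
  have hW : ∀ j : ℕ, W ((adjoint A ^ j) v) = (adjoint B ^ j) w := by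
    intro j
    rcases lt_or_ge j d with hj | hj
    · have e := hb ⟨j, hj⟩
      have e' := hb' ⟨j, hj⟩
      simp only at e e'
      rw [e, e', map_smul, OrthonormalBasis.equiv_apply_basis, norm_ladder_eq hvw hA hB]
      rfl
    · rw [(hA0 j).2 hj, (hB0 j).2 hj, map_zero]
  have hext : ∀ S T : E →L[ℂ] E,
      (∀ j : ℕ, W (S ((adjoint A ^ j) v)) = T (W ((adjoint A ^ j) v))) →
      ∀ x, W (S x) = T (W x) := by
    intro S T h
    have hlin : (W.toLinearEquiv : E →ₗ[ℂ] E) ∘ₗ (S : E →ₗ[ℂ] E) =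
        (T : E →ₗ[ℂ] E) ∘ₗ (W.toLinearEquiv : E →ₗ[ℂ] E) := by
      refine b.toBasis.ext fun j => ?_
      rw [OrthonormalBasis.coe_toBasis]
      have hnorm : (‖(adjoint A ^ (j : ℕ)) v‖ : ℂ) ≠ 0 := by
        rw [Complex.ofReal_ne_zero, norm_ne_zero_iff, Ne, hA0]
        omega
      refine smul_right_injective E hnorm ?_
      simp only [← map_smul]
      rw [← hb j]
      exact h j
    exact fun x => LinearMap.congr_fun hlin x
  refine ⟨W, hext _ _ fun j => ?_, hext _ _ fun j => ?_⟩
  · rw [hW]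
    cases j with
    | zero => simp [hv, hw]
    | succ j => rw [hA, hB, map_smul, hW]
  · have h := hW (j + 1)
    rwa [pow_succ', pow_succ', mul_apply_eq_comp, mul_apply_eq_comp, ← hW j] at h

end Ladder

/-- The lowest weight vector of an irreducible representation generates a ladder whose length is
the dimension of the space. -/
lemma exists_ladder {d : ℕ} (hd : finrank ℂ E = d) [Nontrivial E] {q : ℝ}
    (hq : q ∈ Set.Ioo (0 : ℝ) 1) {A A₁ : E →L[ℂ] E} (hs : adjoint A₁ = A₁)
    (h₁ : A₁ = A * adjoint A - (q : ℂ) ^ 2 • (adjoint A * A))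
    (h₂ : ((q : ℂ) ^ 2) • (A₁ * A) - ((q : ℂ) ^ 2)⁻¹ • (A * A₁) = (1 + (q : ℂ) ^ 2) • A)
    (hirr : ∀ P : E →L[ℂ] E, P * P = P → adjoint P = P → P * A = A * P → P = 0 ∨ P = 1) :
    ∃ (μ : ℂ) (v : E), ‖v‖ = 1 ∧ A v = 0 ∧
      (∀ j, A ((adjoint A ^ (j + 1)) v) = coeff q μ (j + 1) • (adjoint A ^ j) v) ∧
      (∀ j, (adjoint A ^ j) v = 0 ↔ d ≤ j) ∧ coeff q μ d = 0 := by
  obtain ⟨μ, v, hv1, hv, hμ⟩ := exists_lowest hq h₁ h₂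
  have hc j := (ladder_aux hq.1.ne' hs h₁ h₂ hv hμ j).2.2
  have h0 := ladder_eq_zero_iff hd hirr (norm_ne_zero_iff.1 (hv1 ▸ one_ne_zero)) hv hc
  refine ⟨μ, v, hv1, hv, hc, h0, ?_⟩
  obtain ⟨k, rfl⟩ := Nat.exists_eq_succ_of_ne_zero (hd ▸ finrank_pos.ne' : d ≠ 0)
  have h := hc k
  rw [(h0 (k + 1)).2 le_rfl, map_zero, eq_comm, smul_eq_zero, h0] at h
  exact h.resolve_right (by omega)

lemma eq_commutator {q : ℝ} (hq : q ≠ 0) {A₀ A₁ A₂ : E →L[ℂ] E}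
    (h₁ : (q : ℂ) • (A₂ * A₀) - (q : ℂ)⁻¹ • (A₀ * A₂) = A₁)
    (h₂ : A₂ = -((q : ℂ) • adjoint A₀)) :
    A₁ = A₀ * adjoint A₀ - (q : ℂ) ^ 2 • (adjoint A₀ * A₀) := by
  have hq0 : (q : ℂ) ≠ 0 := Complex.ofReal_ne_zero.2 hq
  rw [← h₁, h₂, neg_mul, mul_neg, smul_mul_assoc, mul_smul_comm, smul_neg, smul_neg, smul_smul,
    smul_smul, inv_mul_cancel₀ hq0, one_smul, sq]
  abel

/-- Commuting with `A₀` is enough for an orthogonal projection to commute with the triple. -/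
lemma irreducible_of_triple {q : ℝ} {A₀ A₁ A₂ : E →L[ℂ] E}
    (h₁ : A₁ = A₀ * adjoint A₀ - (q : ℂ) ^ 2 • (adjoint A₀ * A₀))
    (h₂ : A₂ = -((q : ℂ) • adjoint A₀))
    (hirr : ∀ P : E →L[ℂ] E, P * P = P → adjoint P = P →
      P * A₀ = A₀ * P → P * A₁ = A₁ * P → P * A₂ = A₂ * P → P = 0 ∨ P = 1) (P : E →L[ℂ] E)
    (hP : P * P = P) (hPs : adjoint P = P) (hPA : P * A₀ = A₀ * P) : P = 0 ∨ P = 1 := by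
  have hc : Commute P A₀ := hPA
  have hcs : Commute P (adjoint A₀) := by
    have h := hc.star_star
    rwa [star_eq_adjoint, star_eq_adjoint, hPs] at h
  refine hirr P hP hPs hPA ?_ ?_
  · rw [h₁]
    exact (hc.mul_right hcs).sub_right ((hcs.mul_right hc).smul_right _)
  · rw [h₂]
    exact (hcs.smul_right _).neg_right

end InfinitesimalSUq

open ContinuousLinearMap in
/-- Two irreducible infinitesimal representations of SU_q(2) of the same
dimension are unitarily equivalent. -/
theorem stmt16 (q : ℝ) (hq : q ∈ Set.Ioo (0 : ℝ) 1) (n : ℕ)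
    (A₀ A₁ A₂ B₀ B₁ B₂ :
      EuclideanSpace ℂ (Fin (n + 1)) →L[ℂ] EuclideanSpace ℂ (Fin (n + 1)))
    (hA1 : (q : ℂ) • (A₂ * A₀) - (q : ℂ)⁻¹ • (A₀ * A₂) = A₁)
    (hA2 : ((q : ℂ) ^ 2) • (A₁ * A₀) - ((q : ℂ) ^ 2)⁻¹ • (A₀ * A₁)
      = (1 + (q : ℂ) ^ 2) • A₀)
    (hA3 : A₂ = -((q : ℂ) • adjoint A₀))
    (hA4 : adjoint A₁ = A₁)
    (hAirr : ∀ P : EuclideanSpace ℂ (Fin (n + 1)) →L[ℂ] EuclideanSpace ℂ (Fin (n + 1)),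
      P * P = P → adjoint P = P →
      P * A₀ = A₀ * P → P * A₁ = A₁ * P → P * A₂ = A₂ * P → P = 0 ∨ P = 1)
    (hB1 : (q : ℂ) • (B₂ * B₀) - (q : ℂ)⁻¹ • (B₀ * B₂) = B₁)
    (hB2 : ((q : ℂ) ^ 2) • (B₁ * B₀) - ((q : ℂ) ^ 2)⁻¹ • (B₀ * B₁)
      = (1 + (q : ℂ) ^ 2) • B₀)
    (hB3 : B₂ = -((q : ℂ) • adjoint B₀))
    (hB4 : adjoint B₁ = B₁)
    (hBirr : ∀ P : EuclideanSpace ℂ (Fin (n + 1)) →L[ℂ] EuclideanSpace ℂ (Fin (n + 1)),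
      P * P = P → adjoint P = P →
      P * B₀ = B₀ * P → P * B₁ = B₁ * P → P * B₂ = B₂ * P → P = 0 ∨ P = 1) :
    ∃ W : EuclideanSpace ℂ (Fin (n + 1)) →L[ℂ] EuclideanSpace ℂ (Fin (n + 1)),
      adjoint W * W = 1 ∧ W * adjoint W = 1 ∧
      W * A₀ = B₀ * W ∧ W * A₁ = B₁ * W ∧ W * A₂ = B₂ * W := by
  have hq0 := hq.1.ne'
  have hA := InfinitesimalSUq.eq_commutator hq0 hA1 hA3
  have hB := InfinitesimalSUq.eq_commutator hq0 hB1 hB3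
  have hd : Module.finrank ℂ (EuclideanSpace ℂ (Fin (n + 1))) = n + 1 := by simp
  obtain ⟨μ, v, hv1, hv, hvc, hv0, hμ⟩ := InfinitesimalSUq.exists_ladder hd hq hA4 hA hA2
    (InfinitesimalSUq.irreducible_of_triple hA hA3 hAirr)
  obtain ⟨ν, w, hw1, hw, hwc, hw0, hν⟩ := InfinitesimalSUq.exists_ladder hd hq hB4 hB hB2
    (InfinitesimalSUq.irreducible_of_triple hB hB3 hBirr)
  obtain rfl : μ = ν := InfinitesimalSUq.eq_of_coeff_succ_eq hq.1 (hμ.trans hν.symm)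
  obtain ⟨W, hW, hW'⟩ := InfinitesimalSUq.exists_isometry_of_ladders hd (hv1.trans hw1.symm)
    hv hw hvc hwc hv0 hw0
  refine ⟨(W.toContinuousLinearEquiv : _ →L[ℂ] _), ?_, ?_, ?_, ?_, ?_⟩
  · rw [LinearIsometryEquiv.adjoint_eq_symm]
    ext1 x
    exact W.symm_apply_apply x
  · rw [LinearIsometryEquiv.adjoint_eq_symm]
    ext1 x
    exact W.apply_symm_apply x
  · ext1 x
    exact hW x
  · ext1 x
    change W (A₁ x) = B₁ (W x)
    simp [hA, hB, hW, hW']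
  · ext1 x
    change W (A₂ x) = B₂ (W x)
    simp only [hA3, hB3, neg_apply, smul_apply, map_neg, map_smul, hW']
end

section
/- Let n ∈ ℕ and let A₀, A₁, A₂ be (n+1)×(n+1) complex matrices such that: A₁ is diagonal with pairwise distinct diagonal entries; the entry A₀(j,k) is nonzero if and only if j = k+1; and the entry A₂(j,k) is nonzero if and only if k = j+1. Then the only subspaces of ℂ^{n+1} invariant under all three of A₀, A₁, A₂ are 0 and ℂ^{n+1}. -/
section

variable {K ι : Type*} [Field K] [Fintype ι] [DecidableEq ι]

/-- A subspace invariant under a diagonal matrix with distinct entries contains the basis vector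
of every coordinate on which one of its elements is nonzero. -/
theorem Submodule.single_mem_of_diagonal_invariant {d : ι → K} (hd : Function.Injective d)
    {U : Submodule K (ι → K)} (hU : ∀ x ∈ U, (Matrix.diagonal d).mulVec x ∈ U)
    {x : ι → K} (hx : x ∈ U) {j : ι} (hj : x j ≠ 0) : Pi.single j 1 ∈ U := by
  have key (s : Finset ι) : (fun i => (∏ k ∈ s, (d i - d k)) * x i) ∈ U := by
    induction s using Finset.induction_on with
    | empty => simpa using hx
    | insert a s ha ih =>
      convert U.sub_mem (hU _ ih) (U.smul_mem (d a) ih) using 1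
      ext i
      simp only [Finset.prod_insert ha, Pi.sub_apply, Pi.smul_apply, Matrix.mulVec_diagonal,
        smul_eq_mul]
      ring
  have hc : (∏ k ∈ Finset.univ.erase j, (d j - d k)) * x j ≠ 0 := by
    refine mul_ne_zero (Finset.prod_ne_zero_iff.2 fun k hk => ?_) hj
    exact sub_ne_zero.2 (hd.ne (Finset.ne_of_mem_erase hk).symm)
  convert U.smul_mem ((∏ k ∈ Finset.univ.erase j, (d j - d k)) * x j)⁻¹
    (key (Finset.univ.erase j)) using 1
  ext i
  simp only [Pi.smul_apply, smul_eq_mul]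
  by_cases hij : i = j
  · subst hij
    rw [Pi.single_eq_same, inv_mul_cancel₀ hc]
  · have hi : ∏ k ∈ Finset.univ.erase j, (d i - d k) = 0 :=
      Finset.prod_eq_zero (Finset.mem_erase.2 ⟨hij, Finset.mem_univ i⟩) (sub_self _)
    rw [Pi.single_eq_of_ne hij, hi, zero_mul, mul_zero]

/-- If a subspace is invariant under a diagonal matrix with distinct entries and under `A`, then
the basis vectors it contains propagate along the nonzero entries of `A`. -/
theorem Submodule.single_mem_of_entry_ne_zero {d : ι → K} (hd : Function.Injective d)
    {A : Matrix ι ι K} {U : Submodule K (ι → K)}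
    (hU : ∀ x ∈ U, (Matrix.diagonal d).mulVec x ∈ U) (hA : ∀ x ∈ U, A.mulVec x ∈ U)
    {j k : ι} (hkj : A k j ≠ 0) (hj : Pi.single j 1 ∈ U) : Pi.single k 1 ∈ U :=
  single_mem_of_diagonal_invariant hd hU (hA _ hj) (by simpa using hkj)

end

/-- A triple of matrices with A₁ diagonal with distinct entries, A₀ strictly
lower-shift and A₂ strictly upper-shift admits no nontrivial invariant
subspace. -/
theorem stmt17 (n : ℕ) (A₀ A₁ A₂ : Matrix (Fin (n + 1)) (Fin (n + 1)) ℂ)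
    (hdiag : ∀ j k : Fin (n + 1), j ≠ k → A₁ j k = 0)
    (hdist : ∀ j k : Fin (n + 1), j ≠ k → A₁ j j ≠ A₁ k k)
    (hA₀ : ∀ j k : Fin (n + 1), A₀ j k ≠ 0 ↔ (j : ℕ) = (k : ℕ) + 1)
    (hA₂ : ∀ j k : Fin (n + 1), A₂ j k ≠ 0 ↔ (k : ℕ) = (j : ℕ) + 1)
    (U : Submodule ℂ (Fin (n + 1) → ℂ))
    (hU₀ : ∀ x ∈ U, A₀.mulVec x ∈ U)
    (hU₁ : ∀ x ∈ U, A₁.mulVec x ∈ U)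
    (hU₂ : ∀ x ∈ U, A₂.mulVec x ∈ U) :
    U = ⊥ ∨ U = ⊤ := by
  have hd : Function.Injective fun j => A₁ j j := fun j k h => by
    by_contra hjk
    exact hdist j k hjk h
  have hA₁ : A₁ = Matrix.diagonal fun j => A₁ j j := by
    ext j k
    by_cases hjk : j = k
    · simp [hjk]
    · simp [hjk, hdiag j k hjk]
  rw [hA₁] at hU₁
  refine or_iff_not_imp_left.2 fun hU => ?_
  obtain ⟨x, hx, hx0⟩ := U.exists_mem_ne_zero_of_ne_bot hU
  obtain ⟨j, hj⟩ := Function.ne_iff.1 hx0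
  have descend (i : Fin (n + 1)) (hi : Pi.single i 1 ∈ U) : Pi.single 0 1 ∈ U := by
    induction i using Fin.induction with
    | zero => exact hi
    | succ i ih =>
      exact ih (Submodule.single_mem_of_entry_ne_zero hd hU₁ hU₂ ((hA₂ _ _).2 (by simp)) hi)
  have mem_single (i : Fin (n + 1)) : Pi.single i 1 ∈ U := by
    induction i using Fin.induction with
    | zero => exact descend j (Submodule.single_mem_of_diagonal_invariant hd hU₁ hx hj)
    | succ i ih =>
      exact Submodule.single_mem_of_entry_ne_zero hd hU₁ hU₀ ((hA₀ _ _).2 (by simp)) ih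
  refine eq_top_iff.2 fun y _ => ?_
  rw [pi_eq_sum_univ' y]
  exact U.sum_mem fun i _ => U.smul_mem _ (mem_single i)
end
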